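/- arXiv:2103.02527 — 2 statements merged into one kernel-verified Lean document; each statement's English description precedes it below -/
import Mathlib

section
/- Let n be sufficiently large, I ⊆ [n] nonempty, v : I → [n] injective, c : I → [n] with c(i) ≠ v(i) for all i ∈ I. For i ∈ I let S_i be the set of permutations σ of [n] with σ(j) ≠ v(j) for all j ∈ I and σ(i) = c(i). Then |⋃_{i∈I} S_i| ≥ |I|·(n−1)!/7. Consequently, a uniformly random permutation of [n] discriminates v from c with probability at least |I|/(7n). -/
open Nat

open Finset

/-- Permutations avoiding `w` on `I`. -/
def avoidSet {n : ℕ} (I : Finset (Fin n)) (w : Equiv.Perm (Fin n)) :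
    Finset (Equiv.Perm (Fin n)) :=
  Finset.univ.filter (fun σ => ∀ j ∈ I, σ j ≠ w j)

lemma pair_bound {n : ℕ} (I : Finset (Fin n)) (w : Equiv.Perm (Fin n)) (i j p q : Fin n)
    (hij : i ≠ j) :
    ((avoidSet I w).filter (fun σ => σ i = p ∧ σ j = q)).card * ((n - 4) * (n - 5)) ≤
      (avoidSet I w).card := by
  classical
  set S := (avoidSet I w).filter (fun σ => σ i = p ∧ σ j = q) with hS
  let X : Equiv.Perm (Fin n) → Finset (Fin n) := fun σ =>
    Finset.univ \ {i, j, w.symm p, σ.symm (w i)}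
  let Y : Equiv.Perm (Fin n) → Fin n → Finset (Fin n) := fun σ x =>
    Finset.univ \ {i, j, w.symm q, σ.symm (w j), x}
  let T : Equiv.Perm (Fin n) → Finset (Σ _ : Fin n, Fin n) := fun σ =>
    (X σ).sigma (Y σ)
  have hX : ∀ σ, n - 4 ≤ (X σ).card := by
    intro σ
    have h1 := Finset.le_card_sdiff ({i, j, w.symm p, σ.symm (w i)} : Finset (Fin n)) Finset.univ
    have h2 : ({i, j, w.symm p, σ.symm (w i)} : Finset (Fin n)).card ≤ 4 := Finset.card_le_four
    simp only [Finset.card_univ, Fintype.card_fin] at h1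
    exact le_trans (by omega) h1
  have hY : ∀ σ x, n - 5 ≤ (Y σ x).card := by
    intro σ x
    have h1 := Finset.le_card_sdiff ({i, j, w.symm q, σ.symm (w j), x} : Finset (Fin n)) Finset.univ
    have h2 : ({i, j, w.symm q, σ.symm (w j), x} : Finset (Fin n)).card ≤ 5 := Finset.card_le_five
    simp only [Finset.card_univ, Fintype.card_fin] at h1
    exact le_trans (by omega) h1
  have hT : ∀ σ, (n - 4) * (n - 5) ≤ (T σ).card := by
    intro σ
    simp only [T, Finset.card_sigma]
    calc (n - 4) * (n - 5) ≤ (X σ).card * (n - 5) := Nat.mul_le_mul_right _ (hX σ)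
      _ = ∑ x ∈ X σ, (n - 5) := by simp
      _ ≤ _ := Finset.sum_le_sum (fun x _ => hY σ x)
  have h1 : S.card * ((n - 4) * (n - 5)) ≤ (S.sigma T).card := by
    rw [Finset.card_sigma]
    calc _ = ∑ σ ∈ S, ((n - 4) * (n - 5)) := by simp
      _ ≤ _ := Finset.sum_le_sum (fun x _ => hT x)
  refine h1.trans ?_
  have key : ∀ a ∈ S.sigma T,
      (∀ k ∈ I, (a.1 * Equiv.swap i a.2.1 * Equiv.swap j a.2.2) k ≠ w k) ∧
      (a.1 * Equiv.swap i a.2.1 * Equiv.swap j a.2.2) a.2.1 = p ∧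
      (a.1 * Equiv.swap i a.2.1 * Equiv.swap j a.2.2) a.2.2 = q := by
    rintro ⟨σ, x, y⟩ ha
    simp only [Finset.mem_sigma, hS, T, X, Y, avoidSet, Finset.mem_filter, Finset.mem_univ,
      true_and, Finset.mem_sdiff, Finset.mem_insert, Finset.mem_singleton, not_or] at ha
    obtain ⟨⟨hav, hi, hj⟩, ⟨hxi, hxj, hxp, hxw⟩, ⟨hyi, hyj, hyq, hyw, hyx⟩⟩ := ha
    have ex : (σ * Equiv.swap i x * Equiv.swap j y) x = p := by
      simp only [Equiv.Perm.mul_apply]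
      rw [Equiv.swap_apply_of_ne_of_ne hxj (Ne.symm hyx), Equiv.swap_apply_right, hi]
    have ey : (σ * Equiv.swap i x * Equiv.swap j y) y = q := by
      simp only [Equiv.Perm.mul_apply]
      rw [Equiv.swap_apply_right, Equiv.swap_apply_of_ne_of_ne hij.symm (Ne.symm hxj), hj]
    have ei : (σ * Equiv.swap i x * Equiv.swap j y) i = σ x := by
      simp only [Equiv.Perm.mul_apply]
      rw [Equiv.swap_apply_of_ne_of_ne hij (Ne.symm hyi), Equiv.swap_apply_left]
    have ej : (σ * Equiv.swap i x * Equiv.swap j y) j = σ y := by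
      simp only [Equiv.Perm.mul_apply]
      rw [Equiv.swap_apply_left, Equiv.swap_apply_of_ne_of_ne hyi hyx]
    refine ⟨?_, ex, ey⟩
    intro k hk
    dsimp only
    by_cases h1 : k = x
    · subst h1; rw [ex]; intro h; apply hxp; rw [h]; simp
    by_cases h2 : k = y
    · subst h2; rw [ey]; intro h; apply hyq; rw [h]; simp
    by_cases h3 : k = i
    · subst h3; rw [ei]; intro h; apply hxw; rw [← h]; simp
    by_cases h4 : k = j
    · subst h4; rw [ej]; intro h; apply hyw; rw [← h]; simp
    simp only [Equiv.Perm.mul_apply]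
    rw [Equiv.swap_apply_of_ne_of_ne h4 h2, Equiv.swap_apply_of_ne_of_ne h3 h1]
    exact hav k hk
  apply Finset.card_le_card_of_injOn
    (fun a => a.1 * Equiv.swap i a.2.1 * Equiv.swap j a.2.2)
  · intro a ha
    have := (key a (by simpa using ha)).1
    simpa [avoidSet] using this
  · intro a ha b hb hab
    obtain ⟨-, ha1, ha2⟩ := key a (by simpa using ha)
    obtain ⟨-, hb1, hb2⟩ := key b (by simpa using hb)
    dsimp only at hab
    rw [← hab] at hb1 hb2
    have e1 : a.2.1 = b.2.1 := Equiv.injective _ (ha1.trans hb1.symm)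
    have e2 : a.2.2 = b.2.2 := Equiv.injective _ (ha2.trans hb2.symm)
    rw [e1, e2] at hab
    have e0 : a.1 = b.1 := mul_right_cancel (mul_right_cancel hab)
    obtain ⟨a1, a2, a3⟩ := a
    obtain ⟨b1, b2, b3⟩ := b
    simp only at e0 e1 e2
    subst e0 e1 e2
    rfl

lemma two_bound {n : ℕ} (i j p q : Fin n) (hij : i ≠ j) :
    (Finset.univ.filter (fun σ : Equiv.Perm (Fin n) => σ i = p ∧ σ j = q)).card *
      ((n - 4) * (n - 5)) ≤ n ! := by
  have h := pair_bound ∅ 1 i j p q hij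
  have e : avoidSet (∅ : Finset (Fin n)) 1 = Finset.univ := by simp [avoidSet]
  rw [e, Finset.card_univ, Fintype.card_perm, Fintype.card_fin] at h
  exact h

lemma single_bound {n : ℕ} (I : Finset (Fin n)) (w : Equiv.Perm (Fin n)) (i p : Fin n)
    (hi : p ≠ w i) :
    (avoidSet I w).card * ((n - 4) * (n - 5)) ≤
      n * ((avoidSet I w).filter (fun σ => σ i = p)).card * ((n - 4) * (n - 5)) + n * n ! := by
  classical
  have hsub : avoidSet I w ⊆ (avoidSet I w).filter (fun σ => σ i ≠ w (σ.symm p)) ∪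
      (Finset.univ.erase i).biUnion
        (fun x => Finset.univ.filter (fun σ : Equiv.Perm (Fin n) => σ i = w x ∧ σ x = p)) := by
    intro σ hσ
    by_cases h : σ i = w (σ.symm p)
    · apply Finset.mem_union_right
      simp only [Finset.mem_biUnion, Finset.mem_erase, Finset.mem_filter, Finset.mem_univ,
        true_and, and_true]
      refine ⟨σ.symm p, ?_, h, by simp⟩
      intro h'
      apply hi
      rw [h'] at h
      rw [← h, ← h']; simp
    · apply Finset.mem_union_left
      simp [hσ, h]
  have h1 : ((avoidSet I w).filter (fun σ => σ i ≠ w (σ.symm p))).card ≤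
      n * ((avoidSet I w).filter (fun σ => σ i = p)).card := by
    have : n * ((avoidSet I w).filter (fun σ => σ i = p)).card =
        ((Finset.univ : Finset (Fin n)) ×ˢ ((avoidSet I w).filter (fun σ => σ i = p))).card := by
      simp
    rw [this]
    apply Finset.card_le_card_of_injOn (fun σ => (σ.symm p, σ * Equiv.swap i (σ.symm p)))
    · intro σ hσ
      simp only [avoidSet, Finset.coe_filter, Finset.mem_filter, Finset.mem_univ, true_and,
        Set.mem_ofPred_eq] at hσ
      obtain ⟨hav, hne⟩ := hσ
      simp only [avoidSet, Finset.coe_product, Finset.coe_univ, Set.mem_prod, Set.mem_univ,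
        true_and, Finset.coe_filter, Finset.mem_filter, Finset.mem_univ, Set.mem_ofPred_eq,
        Equiv.Perm.mul_apply]
      refine ⟨?_, by simp⟩
      intro k hk
      by_cases h3 : k = i
      · subst h3; simpa using hi
      by_cases h4 : k = σ.symm p
      · rw [h4, Equiv.swap_apply_right]; exact hne
      rw [Equiv.swap_apply_of_ne_of_ne h3 h4]
      exact hav k hk
    · intro σ _ τ _ h
      simp only [Prod.mk.injEq] at h
      obtain ⟨h1, h2⟩ := h
      rw [h1] at h2
      exact mul_right_cancel h2
  have h2 := (Finset.card_le_card hsub).trans (Finset.card_union_le _ _)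
  have h3 : ((Finset.univ.erase i).biUnion
        (fun x => Finset.univ.filter
          (fun σ : Equiv.Perm (Fin n) => σ i = w x ∧ σ x = p))).card * ((n - 4) * (n - 5)) ≤
        n * n ! := by
    refine (Nat.mul_le_mul_right _ Finset.card_biUnion_le).trans ?_
    rw [Finset.sum_mul]
    refine (Finset.sum_le_card_nsmul _ _ (n !) ?_).trans ?_
    · intro x hx
      exact two_bound i x (w x) p (Finset.ne_of_mem_erase hx).symm
    · rw [smul_eq_mul]
      apply Nat.mul_le_mul_right
      exact (Finset.card_le_univ _).trans (by simp)
  calc _ ≤ _ := Nat.mul_le_mul_right _ (h2.trans (Nat.add_le_add_right h1 _))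
    _ ≤ _ := by rw [add_mul]; exact Nat.add_le_add_left h3 _

lemma exists_perm {n : ℕ} (I : Finset (Fin n)) (v : Fin n → Fin n) (hv : Set.InjOn v I) :
    ∃ w : Equiv.Perm (Fin n), ∀ i ∈ I, w i = v i := by
  classical
  obtain ⟨g, hg⟩ := Finset.exists_equiv_extend_of_card_eq (t := (Finset.univ : Finset (Fin n)))
    (by simp) (s := I) (f := v) (by simp) hv
  refine ⟨g.trans (Equiv.subtypeUnivEquiv (by simp)), fun i hi => ?_⟩
  simpa using hg i hi

lemma avoid_ge {n : ℕ} (I : Finset (Fin n)) (w : Equiv.Perm (Fin n)) :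
    numDerangements n ≤ (avoidSet I w).card := by
  classical
  have := card_derangements_eq_numDerangements (Fin n)
  rw [Fintype.card_fin] at this
  rw [← this, ← Set.toFinset_card]
  apply Finset.card_le_card_of_injOn (fun σ => w * σ)
  · intro σ hσ
    have hσ : ∀ x, σ x ≠ x := by
      have h := Set.mem_toFinset.1 (Finset.mem_coe.1 hσ)
      exact h
    simp only [avoidSet, Finset.coe_filter, Finset.mem_univ, true_and, Set.mem_ofPred_eq,
      Equiv.Perm.mul_apply]
    intro j _ h
    exact hσ j (w.injective h)
  · intro σ _ τ _ h
    exact mul_left_cancel h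

lemma derange_ge : ∃ n₀ : ℕ, ∀ n ≥ n₀, (n ! : ℝ) / 3 ≤ numDerangements n := by
  have h := numDerangements_tendsto_inv_e
  have he : (1 / 3 : ℝ) < Real.exp (-1) := by
    rw [Real.exp_neg, one_div]
    apply inv_strictAnti₀ (Real.exp_pos _)
    have := Real.exp_one_lt_d9
    linarith
  have h2 := h.eventually (lt_mem_nhds he)
  obtain ⟨n₀, hn⟩ := Filter.eventually_atTop.1 h2
  refine ⟨n₀, fun n hn' => ?_⟩
  have := hn n hn'
  have hp : (0 : ℝ) < n ! := by exact_mod_cast Nat.factorial_pos n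
  rw [lt_div_iff₀ hp] at this
  linarith

/-- Truncated inclusion-exclusion, doubled. -/
lemma bonferroni {n : ℕ} (A : Finset (Equiv.Perm (Fin n))) (I : Finset (Fin n))
    (c : Fin n → Fin n) :
    2 * ∑ i ∈ I, (A.filter (fun σ => σ i = c i)).card ≤
      2 * (A.filter (fun σ => ∃ i ∈ I, σ i = c i)).card +
      ∑ x ∈ I.offDiag, (A.filter (fun σ => σ x.1 = c x.1 ∧ σ x.2 = c x.2)).card := by
  classical
  simp only [Finset.card_filter]
  rw [Finset.sum_comm, Finset.sum_comm (s := I.offDiag), Finset.mul_sum, Finset.mul_sum,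
    ← Finset.sum_add_distrib]
  apply Finset.sum_le_sum
  intro σ _
  simp only [← Finset.card_filter]
  have e : I.offDiag.filter (fun x => σ x.1 = c x.1 ∧ σ x.2 = c x.2) =
      (I.filter (fun i => σ i = c i)).offDiag := by
    ext x
    simp only [Finset.mem_filter, Finset.mem_offDiag]
    tauto
  rw [e, Finset.offDiag_card]
  set X := I.filter (fun i => σ i = c i) with hX
  by_cases h : ∃ i ∈ I, σ i = c i
  · rw [if_pos h]
    rcases Nat.lt_or_ge X.card 2 with h2 | h2
    · omega
    · obtain ⟨m, hm⟩ := Nat.exists_eq_add_of_le h2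
      rw [hm]
      have : (2 + m) * (2 + m) - (2 + m) = (2 + m) * (1 + m) := by
        rw [Nat.sub_eq_iff_eq_add (by nlinarith)]; ring
      rw [this]
      nlinarith
  · have : X = ∅ := by
      rw [hX, Finset.filter_eq_empty_iff]
      intro i hi hh
      exact h ⟨i, hi, hh⟩
    simp [this]

lemma arith (k n U A S P F G Q : ℝ) (hn : 1000 ≤ n) (hk : 0 < k) (hkn : k ≤ n) (hG : 0 < G)
    (hF : F = n * G) (hQ : Q = (n - 4) * (n - 5)) (hA : F / 3 ≤ A) 
    (hS : k * (A * Q) ≤ n * S * Q + k * (n * F)) (hP : P * Q ≤ k * (k - 1) * A)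
    (hB : 2 * S ≤ 2 * U + P) : k * G / 7 ≤ U := by
  have hQ0 : 0 < Q := by rw [hQ]; nlinarith
  have hAp : 0 ≤ A := le_trans (by rw [hF]; positivity) hA
  have h1 : n * Q * (2 * S) ≤ n * Q * (2 * U + P) :=
    mul_le_mul_of_nonneg_left hB (by positivity)
  have h2 : n * (P * Q) ≤ n * (k * (n - 1) * A) := by
    apply mul_le_mul_of_nonneg_left _ (by linarith)
    refine hP.trans ?_
    apply mul_le_mul_of_nonneg_right _ hAp
    apply mul_le_mul_of_nonneg_left _ hk.le
    linarith
  have h3 : k * (A * (2 * Q - n * (n - 1)) - 2 * n * F) ≤ 2 * n * Q * U := by nlinarith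
  have h4 : 0 ≤ 2 * Q - n * (n - 1) := by rw [hQ]; nlinarith
  have h5 : F / 3 * (2 * Q - n * (n - 1)) ≤ A * (2 * Q - n * (n - 1)) :=
    mul_le_mul_of_nonneg_right hA h4
  have h6 : k * (F / 3 * (2 * Q - n * (n - 1)) - 2 * n * F) ≤ 2 * n * Q * U :=
    le_trans (mul_le_mul_of_nonneg_left (by linarith) hk.le) h3
  have h7 : 0 ≤ (2 * Q - n * (n - 1)) / 3 - 2 * n - 2 * Q / 7 := by rw [hQ]; nlinarith
  have h8 : 0 ≤ k * F * ((2 * Q - n * (n - 1)) / 3 - 2 * n - 2 * Q / 7) := by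
    apply mul_nonneg _ h7
    rw [hF]; positivity
  have h9 : (2 * n * Q) * (k * G / 7) ≤ (2 * n * Q) * U := by
    refine le_trans ?_ h6
    have : (2 * n * Q) * (k * G / 7) = k * F * (2 * Q / 7) := by rw [hF]; ring
    rw [this]
    linarith
  exact le_of_mul_le_mul_left h9 (by positivity)

/-- For large `n`, the set of permutations discriminating `v` from `c` on a
nonempty `I` has size at least `|I| (n-1)!/7`, so a uniformly random
permutation discriminates with probability at least `|I|/(7n)`. -/
theorem stmt_15 :
    ∃ n₀ : ℕ, ∀ n ≥ n₀, ∀ (I : Finset (Fin n)), I.Nonempty →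
      ∀ (v c : Fin n → Fin n), Set.InjOn v I → (∀ i ∈ I, c i ≠ v i) →
        (((Finset.univ.filter
            (fun σ : Equiv.Perm (Fin n) =>
              (∀ j ∈ I, σ j ≠ v j) ∧ ∃ i ∈ I, σ i = c i)).card : ℝ) ≥
          (I.card : ℝ) * (n - 1)! / 7) ∧
        (((Finset.univ.filter
            (fun σ : Equiv.Perm (Fin n) =>
              (∀ j ∈ I, σ j ≠ v j) ∧ ∃ i ∈ I, σ i = c i)).card : ℝ) / n ! ≥
          (I.card : ℝ) / (7 * n)) := by
  obtain ⟨n₁, hn₁⟩ := derange_ge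
  refine ⟨max n₁ 1000, fun n hn I hI v c hv hc => ?_⟩
  have hn1 : n₁ ≤ n := le_trans (le_max_left _ _) hn
  have hn2 : 1000 ≤ n := le_trans (le_max_right _ _) hn
  obtain ⟨w, hw⟩ := exists_perm I v hv
  have hset : (Finset.univ.filter
            (fun σ : Equiv.Perm (Fin n) =>
              (∀ j ∈ I, σ j ≠ v j) ∧ ∃ i ∈ I, σ i = c i)) =
      (avoidSet I w).filter (fun σ => ∃ i ∈ I, σ i = c i) := by
    rw [avoidSet, Finset.filter_filter]
    apply Finset.filter_congr
    intro σ _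
    apply and_congr_left
    intro _
    exact forall₂_congr (fun j hj => by rw [hw j hj])
  rw [hset]
  set U := ((avoidSet I w).filter (fun σ => ∃ i ∈ I, σ i = c i)).card with hU
  have hfac : (n ! : ℝ) = n * (n - 1)! := by
    exact_mod_cast (Nat.mul_factorial_pred (by omega)).symm
  have hG : (0 : ℝ) < (n - 1)! := by exact_mod_cast Nat.factorial_pos _
  have hn0 : (0 : ℝ) < n := by exact_mod_cast (by omega : 0 < n)
  have hB := bonferroni (avoidSet I w) I c
  rw [← hU] at hB
  have hQ : (((n - 4) * (n - 5) : ℕ) : ℝ) = ((n : ℝ) - 4) * (n - 5) := by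
    rw [Nat.cast_mul, Nat.cast_sub (by omega), Nat.cast_sub (by omega)]; norm_num
  have hS : I.card * ((avoidSet I w).card * ((n - 4) * (n - 5))) ≤
      n * (∑ i ∈ I, ((avoidSet I w).filter (fun σ => σ i = c i)).card) * ((n - 4) * (n - 5))
        + I.card * (n * n !) := by
    have := Finset.sum_le_sum (s := I) (fun i hi => single_bound I w i (c i)
      (by rw [hw i hi]; exact hc i hi))
    rw [Finset.sum_add_distrib, Finset.sum_const, Finset.sum_const, ← Finset.sum_mul,
      ← Finset.mul_sum] at this
    simpa only [smul_eq_mul] using this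
  have hP : (∑ x ∈ I.offDiag,
      ((avoidSet I w).filter (fun σ => σ x.1 = c x.1 ∧ σ x.2 = c x.2)).card) *
        ((n - 4) * (n - 5)) ≤ (I.card * I.card - I.card) * (avoidSet I w).card := by
    rw [Finset.sum_mul, ← Finset.offDiag_card, ← smul_eq_mul]
    apply Finset.sum_le_card_nsmul
    intro x hx
    exact pair_bound I w x.1 x.2 _ _ (Finset.mem_offDiag.1 hx).2.2
  have hmain : (I.card : ℝ) * (n - 1)! / 7 ≤ U := by
    refine arith I.card n U (avoidSet I w).card
      ((∑ i ∈ I, ((avoidSet I w).filter (fun σ => σ i = c i)).card : ℕ) : ℝ)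
      ((∑ x ∈ I.offDiag,
        ((avoidSet I w).filter (fun σ => σ x.1 = c x.1 ∧ σ x.2 = c x.2)).card : ℕ) : ℝ)
      (n !) ((n - 1)!) (((n - 4) * (n - 5) : ℕ) : ℝ)
      (by exact_mod_cast hn2) (by exact_mod_cast hI.card_pos) ?_ hG hfac hQ ?_ ?_ ?_ ?_
    · have := Finset.card_le_univ I
      rw [Fintype.card_fin] at this
      exact_mod_cast this
    · exact (hn₁ n hn1).trans (by exact_mod_cast avoid_ge I w)
    · exact_mod_cast hS
    · have h := (Nat.cast_le (α := ℝ)).2 hP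
      rw [Nat.cast_mul, Nat.cast_mul (I.card * I.card - I.card), Nat.cast_sub (Nat.le_mul_self _),
        Nat.cast_mul I.card] at h
      refine h.trans (le_of_eq ?_)
      ring
    · exact_mod_cast hB
  refine ⟨hmain, ?_⟩
  rw [ge_iff_le, hfac, div_le_div_iff₀ (by positivity) (by positivity)]
  have := mul_le_mul_of_nonneg_left hmain (by positivity : (0 : ℝ) ≤ 7 * n)
  calc _ = 7 * (n : ℝ) * ((I.card : ℝ) * (n - 1)! / 7) := by ring
    _ ≤ _ := this
    _ = _ := by ring
end

section
/- For Static Permutation Mastermind on n positions and n colours, there exists a set Q of O(n log n) permutation queries such that every secret permutation codeword σ is uniquely determined by the vector of answers (|{i : q(i) = σ(i)}|)_{q∈Q}; explicitly, for sufficiently large n, |Q| ≤ 28 n log n suffices. -/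
open Finset

namespace PM

/-- signed contribution of value `c` at position `i` -/
def f {n : ℕ} (σ τ : Equiv.Perm (Fin n)) (i c : Fin n) : ℤ :=
  (if c = σ i then 1 else 0) - (if c = τ i then 1 else 0)

def X {n : ℕ} (σ τ q : Equiv.Perm (Fin n)) : ℤ := ∑ i, f σ τ i (q i)

def C {n : ℕ} (σ τ : Equiv.Perm (Fin n)) (a b : Fin n) (q : Equiv.Perm (Fin n)) : Prop :=
  f σ τ a (q a) + f σ τ b (q b) ≠ f σ τ a (q b) + f σ τ b (q a)

lemma X_swap {n : ℕ} (σ τ q : Equiv.Perm (Fin n)) (a b : Fin n) (hab : a ≠ b)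
    (h : C σ τ a b q) : X σ τ (q * Equiv.swap a b) ≠ X σ τ q := by
  intro hX
  apply h
  unfold X at hX
  have hb : b ∈ univ.erase a := by simp [hab.symm]
  rw [← Finset.add_sum_erase _ _ (mem_univ a), ← Finset.add_sum_erase _ _ hb,
    ← Finset.add_sum_erase univ (fun i => f σ τ i (q i)) (mem_univ a),
    ← Finset.add_sum_erase _ (fun i => f σ τ i (q i)) hb] at hX
  have : ∑ x ∈ (univ.erase a).erase b, f σ τ x ((q * Equiv.swap a b) x)
      = ∑ x ∈ (univ.erase a).erase b, f σ τ x (q x) := by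
    apply Finset.sum_congr rfl
    intro x hx
    simp only [mem_erase] at hx
    rw [Equiv.Perm.mul_apply, Equiv.swap_apply_of_ne_of_ne hx.2.1 hx.1]
  rw [this] at hX
  simp only [Equiv.Perm.mul_apply, Equiv.swap_apply_left, Equiv.swap_apply_right] at hX
  linarith

lemma invol {n k : ℕ} (σ τ : Equiv.Perm (Fin n)) (e : Fin k × Bool → Fin n)
    (he : Function.Injective e) :
    (by classical exact (univ.filter fun q : Equiv.Perm (Fin n) =>
      ∃ l, C σ τ (e (l, false)) (e (l, true)) q).card)
      ≤ 2 * (univ.filter fun q => X σ τ q ≠ 0).card := by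
  classical
  have hne : ∀ l, e (l, false) ≠ e (l, true) := fun l h => by simpa using he h
  set s : Fin k → Equiv.Perm (Fin n) := fun l => Equiv.swap (e (l, false)) (e (l, true)) with hs
  set P : Equiv.Perm (Fin n) → Fin k → Prop :=
    fun q l => C σ τ (e (l, false)) (e (l, true)) q with hP
  have hinv : ∀ q m, P (q * s m) = P q := by
    intro q m
    funext l
    apply propext
    by_cases hlm : l = m
    · subst hlm
      simp only [hP, C, hs, Equiv.Perm.mul_apply, Equiv.swap_apply_left, Equiv.swap_apply_right]
      exact ne_comm
    · have h : ∀ x, s m (e (l, x)) = e (l, x) := by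
        intro x
        apply Equiv.swap_apply_of_ne_of_ne
        · intro h; have := he h; simp_all
        · intro h; have := he h; simp_all
      simp only [hP, C, Equiv.Perm.mul_apply, h]
  set U := univ.filter fun q : Equiv.Perm (Fin n) => ∃ l, P q l with hU
  change U.card ≤ _
  rw [← Finset.card_filter_add_card_filter_not (s := U) (fun q => X σ τ q ≠ 0), two_mul]
  apply add_le_add
  · exact Finset.card_le_card (Finset.filter_subset_filter _ (subset_univ _))
  · by_cases hk : Nonempty (Fin k)
    · apply Finset.card_le_card_of_injOn (fun q => q * s (Classical.epsilon (P q)))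
      · intro q hq
        simp only [hU, coe_filter, mem_filter, mem_univ, true_and, Set.mem_ofPred_eq, not_not] at hq ⊢
        have := X_swap σ τ q _ _ (hne _) (Classical.epsilon_spec hq.1)
        exact fun h0 => this (h0.trans hq.2.symm)
      · intro q _ q' _ h
        simp only at h
        have h1 : P q = P q' := by
          rw [← hinv q (Classical.epsilon (P q)), h, hinv]
        rw [h1] at h
        exact mul_right_cancel h
    · have : U = ∅ := by
        rw [hU, Finset.filter_eq_empty_iff]
        rintro q _ ⟨l, _⟩
        exact hk ⟨l⟩
      simp [this]

lemma card1 {n : ℕ} (i c : Fin n) :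
    n * (univ.filter fun q : Equiv.Perm (Fin n) => q i = c).card = n.factorial := by
  have h1 : ∀ c', (univ.filter fun q : Equiv.Perm (Fin n) => q i = c').card
      = (univ.filter fun q : Equiv.Perm (Fin n) => q i = c).card := by
    intro c'
    apply Finset.card_bij (fun q _ => Equiv.swap c' c * q)
    · intro q hq; simp at hq; simp [hq]
    · intro q _ q' _ h; exact mul_left_cancel h
    · intro q hq
      refine ⟨Equiv.swap c' c * q, ?_, ?_⟩
      · simp at hq; simp [hq]
      · simp [← mul_assoc]
  have h2 := Finset.card_eq_sum_card_fiberwise (s := (univ : Finset (Equiv.Perm (Fin n))))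
    (t := univ) (f := fun q => q i) (by intro x _; simp)
  rw [Finset.sum_congr rfl (fun c' _ => h1 c')] at h2
  simp [Fintype.card_perm] at h2
  exact h2.symm

lemma card2 {n : ℕ} (i j c d : Fin n) (hij : i ≠ j) :
    (n - 1) * (univ.filter fun q : Equiv.Perm (Fin n) => q i = c ∧ q j = d).card
      ≤ (univ.filter fun q : Equiv.Perm (Fin n) => q i = c).card := by
  by_cases hcd : c = d
  · have : (univ.filter fun q : Equiv.Perm (Fin n) => q i = c ∧ q j = d) = ∅ := by
      rw [Finset.filter_eq_empty_iff]
      rintro q _ ⟨h1, h2⟩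
      exact hij (q.injective (by rw [h1, h2, hcd]))
    simp [this]
  have h1 : ∀ d' ∈ univ.erase c,
      ((univ.filter fun q : Equiv.Perm (Fin n) => q i = c).filter (fun q => q j = d')).card
      = (univ.filter fun q : Equiv.Perm (Fin n) => q i = c ∧ q j = d).card := by
    intro d' hd'
    have hd' : c ≠ d' := by simpa [eq_comm] using hd'
    rw [Finset.filter_filter]
    apply Finset.card_bij (fun q _ => Equiv.swap d' d * q)
    · intro q hq; simp at hq; simp [hq, Equiv.swap_apply_of_ne_of_ne hd' hcd]
    · intro q _ q' _ h; exact mul_left_cancel h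
    · intro q hq
      refine ⟨Equiv.swap d' d * q, ?_, ?_⟩
      · simp at hq; simp [hq, Equiv.swap_apply_of_ne_of_ne hd' hcd]
      · simp [← mul_assoc]
  have h2 := Finset.card_eq_sum_card_fiberwise
    (s := (univ.filter fun q : Equiv.Perm (Fin n) => q i = c))
    (t := univ.erase c) (f := fun q => q j) (by
      intro q hq
      simp at hq
      simp only [coe_erase, coe_univ, Set.mem_sdiff, Set.mem_univ, Set.mem_singleton_iff, true_and]
      intro h
      exact hij (q.injective (by rw [hq, h])))
  rw [Finset.sum_congr rfl h1] at h2
  simp at h2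
  exact h2.ge

/-- the favourable event at position `i` with partner `j` -/
def E {n : ℕ} (σ τ : Equiv.Perm (Fin n)) (i j : Fin n) : Finset (Equiv.Perm (Fin n)) :=
  univ.filter fun q => q i = σ i ∧ q j ≠ τ i ∧ q j ≠ σ j ∧ q j ≠ τ j

lemma E_C {n : ℕ} (σ τ : Equiv.Perm (Fin n)) (i j : Fin n) (hij : i ≠ j) (hi : σ i ≠ τ i)
    (q : Equiv.Perm (Fin n)) (hq : q ∈ E σ τ i j) :
    f σ τ i (q i) + f σ τ j (q j) ≠ f σ τ i (q j) + f σ τ j (q i) := by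
  simp only [E, mem_filter, mem_univ, true_and] at hq
  obtain ⟨h1, h2, h3, h4⟩ := hq
  have h5 : q j ≠ σ i := by rw [← h1]; exact fun h => hij (q.injective h.symm)
  have h6 : σ i ≠ σ j := fun h => hij (σ.injective h)
  simp only [f, h1, h2, h3, h4, h5, h6, hi, if_true, if_false]
  split_ifs <;> simp

lemma E_card {n : ℕ} (σ τ : Equiv.Perm (Fin n)) (i j : Fin n) (hij : i ≠ j) (hn : 25 ≤ n) :
    (n.factorial : ℝ) / n * (1 - 3 / (n - 1)) ≤ (E σ τ i j).card := by
  have hn' : (25 : ℝ) ≤ n := by exact_mod_cast hn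
  have c1 : ((univ.filter fun q : Equiv.Perm (Fin n) => q i = σ i).card : ℝ)
      = n.factorial / n := by
    rw [eq_div_iff (by positivity), mul_comm]
    exact_mod_cast card1 i (σ i)
  have c2 : ∀ d, ((univ.filter fun q : Equiv.Perm (Fin n) => q i = σ i ∧ q j = d).card : ℝ)
      ≤ n.factorial / n / (n - 1) := by
    intro d
    rw [le_div_iff₀ (by linarith), ← c1, mul_comm]
    have := card2 i j (σ i) d hij
    have h : ((n - 1 : ℕ) : ℝ) = n - 1 := by push_cast [show 1 ≤ n by omega]; ring
    rw [← h]
    exact_mod_cast this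
  have hsub : (univ.filter fun q : Equiv.Perm (Fin n) => q i = σ i) ⊆
      E σ τ i j ∪ ((univ.filter fun q : Equiv.Perm (Fin n) => q i = σ i ∧ q j = τ i) ∪
       ((univ.filter fun q : Equiv.Perm (Fin n) => q i = σ i ∧ q j = σ j) ∪
        (univ.filter fun q : Equiv.Perm (Fin n) => q i = σ i ∧ q j = τ j))) := by
    intro q hq
    simp only [E, mem_union, mem_filter, mem_univ, true_and] at hq ⊢
    tauto
  have hle := (Finset.card_le_card hsub).trans ((Finset.card_union_le _ _).trans
    (add_le_add le_rfl ((Finset.card_union_le _ _).trans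
      (add_le_add le_rfl (Finset.card_union_le _ _)))))
  have hle' : ((univ.filter fun q : Equiv.Perm (Fin n) => q i = σ i).card : ℝ) ≤ _ :=
    Nat.cast_le.mpr hle
  push_cast at hle'
  have e1 := c2 (τ i)
  have e2 := c2 (σ j)
  have e3 := c2 (τ j)
  have : (n.factorial : ℝ) / n * (1 - 3 / (n - 1)) =
    n.factorial / n - 3 * (n.factorial / n / (n - 1)) := by ring
  linarith

lemma EE_card {n : ℕ} (σ τ : Equiv.Perm (Fin n)) (i j i' j' : Fin n) (hii : i ≠ i')
    (hn : 25 ≤ n) :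
    (((E σ τ i j) ∩ (E σ τ i' j')).card : ℝ) ≤ n.factorial / n / (n - 1) := by
  have hn' : (25 : ℝ) ≤ n := by exact_mod_cast hn
  have c1 : ((univ.filter fun q : Equiv.Perm (Fin n) => q i = σ i).card : ℝ)
      = n.factorial / n := by
    rw [eq_div_iff (by positivity), mul_comm]
    exact_mod_cast card1 i (σ i)
  rw [le_div_iff₀ (by linarith), ← c1, mul_comm]
  have := card2 i i' (σ i) (σ i') hii
  have h : ((n - 1 : ℕ) : ℝ) = n - 1 := by push_cast [show 1 ≤ n by omega]; ring
  rw [← h]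
  have h2 : (E σ τ i j) ∩ (E σ τ i' j') ⊆
      univ.filter fun q : Equiv.Perm (Fin n) => q i = σ i ∧ q i' = σ i' := by
    intro q hq
    simp only [E, mem_inter, mem_filter, mem_univ, true_and] at hq ⊢
    tauto
  have h3 := (Nat.mul_le_mul_left (n-1) (Finset.card_le_card h2)).trans this
  exact_mod_cast h3

/-- Bonferroni -/
lemma bonf {α ι : Type*} [DecidableEq α] [Fintype ι] [DecidableEq ι] (A : ι → Finset α)
    (U : Finset α) (hU : ∀ i, A i ⊆ U) :
    2 * ∑ i, ((A i).card : ℝ) - ∑ i, ∑ j ∈ univ.erase i, ((A i ∩ A j).card : ℝ)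
      ≤ 2 * U.card := by
  have h1 : ∀ i, ((A i).card : ℝ) = ∑ x ∈ U, if x ∈ A i then (1:ℝ) else 0 := by
    intro i
    rw [Finset.sum_boole, Finset.filter_mem_eq_inter, Finset.inter_eq_right.mpr (hU i)]
  have h2 : ∀ i j, ((A i ∩ A j).card : ℝ) =
      ∑ x ∈ U, (if x ∈ A i then (1:ℝ) else 0) * (if x ∈ A j then (1:ℝ) else 0) := by
    intro i j
    have : ∀ x, (if x ∈ A i then (1:ℝ) else 0) * (if x ∈ A j then (1:ℝ) else 0)
      = if x ∈ A i ∩ A j then (1:ℝ) else 0 := by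
      intro x; simp only [mem_inter]; split_ifs <;> simp_all
    simp only [this]
    rw [Finset.sum_boole, Finset.filter_mem_eq_inter,
      Finset.inter_eq_right.mpr (inter_subset_left.trans (hU i))]
  have h3 : ∀ i, ∑ j ∈ univ.erase i, ((A i ∩ A j).card : ℝ) =
      ∑ j, ((A i ∩ A j).card : ℝ) - (A i).card := by
    intro i
    rw [← Finset.add_sum_erase univ _ (mem_univ i), Finset.inter_self]; ring
  simp only [h3, Finset.sum_sub_distrib]
  have h4 : ∑ i, ∑ j, ((A i ∩ A j).card : ℝ)
      = ∑ x ∈ U, (∑ i, if x ∈ A i then (1:ℝ) else 0)^2 := by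
    simp only [h2, sq, Finset.sum_mul_sum]
    rw [Finset.sum_comm (s := U)]
    apply Finset.sum_congr rfl
    intro i _
    rw [Finset.sum_comm (s := U)]
  have h5 : ∑ i, ((A i).card : ℝ) = ∑ x ∈ U, ∑ i, if x ∈ A i then (1:ℝ) else 0 := by
    simp only [h1]; rw [Finset.sum_comm]
  rw [h4, h5]
  have h6 : 2 * (U.card : ℝ) = ∑ x ∈ U, 2 := by simp [mul_comm]
  rw [h6, Finset.mul_sum, ← Finset.sum_sub_distrib, ← Finset.sum_sub_distrib]
  apply Finset.sum_le_sum
  intro x _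
  rw [Finset.sum_boole]
  generalize (univ.filter fun i => x ∈ A i).card = N
  rcases N with _ | _ | N
  · norm_num
  · norm_num
  · push_cast
    nlinarith [(Nat.cast_nonneg N : (0:ℝ) ≤ N)]

lemma main {n : ℕ} (hn : 25 ≤ n) (σ τ : Equiv.Perm (Fin n)) (h : σ ≠ τ) :
    (n.factorial : ℝ) * (((univ.filter fun i => σ i ≠ τ i).card : ℝ) / (8 * n)) ≤
      (univ.filter fun q => X σ τ q ≠ 0).card := by
  classical
  have hn' : (25 : ℝ) ≤ n := by exact_mod_cast hn
  set D := univ.filter fun i => σ i ≠ τ i with hD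
  have hd2 : 2 ≤ D.card := by
    obtain ⟨i, hi⟩ : ∃ i, σ i ≠ τ i := by
      by_contra hc; push Not at hc; exact h (Equiv.ext hc)
    have h1 : i ∈ D := by simp [hD, hi]
    have h2 : σ.symm (τ i) ∈ D := by
      simp only [hD, mem_filter, mem_univ, true_and, Equiv.apply_symm_apply]
      intro hc
      apply hi
      have := τ.injective hc
      conv_lhs => rw [this]
      simp
    exact Finset.one_lt_card.mpr ⟨i, h1, _, h2, fun hc => hi (by
      conv_lhs => rw [hc]
      simp)⟩
  obtain ⟨k, hk⟩ : ∃ k, k = D.card / 2 := ⟨_, rfl⟩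
  have hk1 : 2 * k ≤ D.card := by omega
  have hk3 : D.card ≤ 3 * k := by omega
  have hDn : D.card ≤ n := by simpa using Finset.card_le_univ D
  have hemb : Nonempty (Fin k × Bool ↪ D) := by
    apply Function.Embedding.nonempty_of_card_le
    simp; omega
  obtain ⟨e0⟩ := hemb
  set e : Fin k × Bool → Fin n := fun p => (e0 p : Fin n) with he
  have hinj : Function.Injective e := Subtype.val_injective.comp e0.injective
  have heD : ∀ p, σ (e p) ≠ τ (e p) := fun p => by
    exact (mem_filter.mp (e0 p).2).2
  have hI := invol σ τ e hinj
  set U := (univ.filter fun q : Equiv.Perm (Fin n) =>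
      ∃ l, C σ τ (e (l, false)) (e (l, true)) q) with hU
  have hI' : (U.card : ℝ) ≤ 2 * (univ.filter fun q => X σ τ q ≠ 0).card := by exact_mod_cast hI
  have hne : ∀ l x, e (l, x) ≠ e (l, !x) := fun l x hc => by
    have := hinj hc; simp at this
  have hB := bonf (fun p : Fin k × Bool => E σ τ (e p) (e (p.1, !p.2))) U (by
    rintro ⟨l, x⟩ q hq
    simp only [hU, mem_filter, mem_univ, true_and]
    refine ⟨l, ?_⟩
    have := E_C σ τ _ _ (hne l x) (heD _) q hq
    cases x
    · exact this
    · unfold C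
      simp only [Bool.not_true] at this
      intro hc
      apply this
      linarith)
  set c := (n.factorial : ℝ) / n with hc
  have hcpos : 0 < c := by positivity
  have hS1 : (2 * k : ℝ) * (c * (1 - 3 / (n - 1))) ≤
      ∑ p : Fin k × Bool, ((E σ τ (e p) (e (p.1, !p.2))).card : ℝ) := by
    have := Finset.card_nsmul_le_sum (univ : Finset (Fin k × Bool))
      (fun p => ((E σ τ (e p) (e (p.1, !p.2))).card : ℝ)) (c * (1 - 3 / (n - 1)))
      (fun p _ => E_card σ τ _ _ (hne p.1 p.2) hn)
    simp only [card_univ, Fintype.card_prod, Fintype.card_fin, Fintype.card_bool, nsmul_eq_mul] at this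
    push_cast at this
    linarith
  have hS2 : ∑ p : Fin k × Bool, ∑ p' ∈ univ.erase p,
      (((E σ τ (e p) (e (p.1, !p.2))) ∩ (E σ τ (e p') (e (p'.1, !p'.2)))).card : ℝ)
      ≤ (2 * k : ℝ) * c := by
    have h1 : ∀ p : Fin k × Bool, ∑ p' ∈ univ.erase p,
      (((E σ τ (e p) (e (p.1, !p.2))) ∩ (E σ τ (e p') (e (p'.1, !p'.2)))).card : ℝ) ≤ c := by
      intro p
      refine (Finset.sum_le_card_nsmul _ _ (c / (n - 1)) ?_).trans ?_
      · intro p' hp'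
        apply EE_card _ _ _ _ _ _ _ hn
        intro hc
        simp [hinj hc] at hp'
      · rw [nsmul_eq_mul, mul_div_assoc', div_le_iff₀ (by linarith), mul_comm]
        apply mul_le_mul_of_nonneg_left _ hcpos.le
        have : (univ.erase p).card + 1 ≤ n := by
          rw [Finset.card_erase_add_one (mem_univ _)]
          simp; omega
        have : ((univ.erase p).card : ℝ) + 1 ≤ n := by exact_mod_cast this
        linarith
    have := Finset.sum_le_card_nsmul (univ : Finset (Fin k × Bool)) _ c (fun p _ => h1 p)
    simp only [card_univ, Fintype.card_prod, Fintype.card_fin, Fintype.card_bool, nsmul_eq_mul] at this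
    push_cast at this
    linarith
  have h8 : (3 : ℝ) / (n - 1) ≤ 1 / 8 := by
    rw [div_le_div_iff₀ (by linarith) (by norm_num)]; linarith
  have hk3' : (D.card : ℝ) ≤ 3 * k := by exact_mod_cast hk3
  have hfin : (n.factorial : ℝ) * ((D.card : ℝ) / (8 * n)) = c * D.card / 8 := by
    rw [hc]; field_simp
  rw [hfin]
  have hkc : 0 ≤ (k : ℝ) * c := by positivity
  have g1 : (k : ℝ) * c * (3 / (n - 1)) ≤ k * c * (1 / 8) := mul_le_mul_of_nonneg_left h8 hkc
  have g2 : c * (D.card : ℝ) ≤ c * (3 * k) := mul_le_mul_of_nonneg_left hk3' hcpos.le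
  have g3 : (2 * k : ℝ) * (c * (1 - 3 / (n - 1))) = 2 * (k * c) - 2 * (k * c * (3 / (n - 1))) := by
    ring
  linarith

/-- triples data -/
def Z {n : ℕ} (T : Finset (Fin n × Fin n × Fin n)) : Finset (Equiv.Perm (Fin n)) :=
  univ.filter fun q => ∑ t ∈ T,
    ((if q t.1 = t.2.1 then 1 else 0) - (if q t.1 = t.2.2 then 1 else 0) : ℤ) = 0

def T {n : ℕ} (σ τ : Equiv.Perm (Fin n)) : Finset (Fin n × Fin n × Fin n) :=
  (univ.filter fun i => σ i ≠ τ i).image fun i => (i, σ i, τ i)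

lemma T_card {n : ℕ} (σ τ : Equiv.Perm (Fin n)) :
    (T σ τ).card = (univ.filter fun i => σ i ≠ τ i).card :=
  Finset.card_image_of_injective _ (fun i j h => (Prod.ext_iff.mp h).1)

lemma Z_iff {n : ℕ} (σ τ q : Equiv.Perm (Fin n)) : q ∈ Z (T σ τ) ↔ X σ τ q = 0 := by
  have : ∑ t ∈ T σ τ,
    ((if q t.1 = t.2.1 then 1 else 0) - (if q t.1 = t.2.2 then 1 else 0) : ℤ) = X σ τ q := by
    unfold T X f
    rw [Finset.sum_image (fun i _ j _ h => (Prod.ext_iff.mp h).1)]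
    apply Finset.sum_subset (subset_univ _)
    intro i _ hi
    have hi : σ i = τ i := by simpa using hi
    simp [hi]
  simp only [Z, mem_filter, mem_univ, true_and, this]

lemma X_iff {n : ℕ} (σ τ q : Equiv.Perm (Fin n)) : X σ τ q = 0 ↔
    (Finset.univ.filter (fun i => q i = σ i)).card =
      (Finset.univ.filter (fun i => q i = τ i)).card := by
  unfold X f
  rw [Finset.sum_sub_distrib, Finset.sum_boole, Finset.sum_boole, sub_eq_zero]
  exact Nat.cast_inj

lemma Z_card {n : ℕ} (hn : 25 ≤ n) (σ τ : Equiv.Perm (Fin n)) (h : σ ≠ τ) (m : ℕ) :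
    ((Z (T σ τ)).card : ℝ) ^ m ≤
      (n.factorial : ℝ) ^ m * Real.exp (-(m / (8 * n))) ^ (T σ τ).card := by
  have h1 := main hn σ τ h
  rw [← T_card] at h1
  have h2 : (Z (T σ τ)).card + (univ.filter fun q => X σ τ q ≠ 0).card = n.factorial := by
    have : Z (T σ τ) = univ.filter fun q => X σ τ q = 0 := by
      ext q; simp [Z_iff]
    rw [this, Finset.card_filter_add_card_filter_not]
    simp [Fintype.card_perm]
  have h2' : ((Z (T σ τ)).card : ℝ) + (univ.filter fun q => X σ τ q ≠ 0).card = n.factorial := by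
    exact_mod_cast h2
  set d := (T σ τ).card
  have h3 : ((Z (T σ τ)).card : ℝ) ≤ n.factorial * Real.exp (-(d / (8 * n))) := by
    have := Real.add_one_le_exp (-((d : ℝ) / (8 * n)))
    have := mul_le_mul_of_nonneg_left this (Nat.cast_nonneg n.factorial : (0:ℝ) ≤ _)
    linarith
  refine (pow_le_pow_left₀ (Nat.cast_nonneg _) h3 m).trans (le_of_eq ?_)
  rw [mul_pow, ← Real.exp_nat_mul, ← Real.exp_nat_mul]
  congr 2
  ring

lemma num {n : ℕ} (hn : 100 ≤ n) (m : ℕ) (hm : 28 * n * Real.log n < m + 1) :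
    (1 + Real.exp (-(m / (8 * n)))) ^ (n ^ 3) < 2 := by
  have hn' : (100 : ℝ) ≤ n := by exact_mod_cast hn
  have hlog : 4 ≤ Real.log n := by
    rw [Real.le_log_iff_exp_le (by linarith)]
    refine le_trans ?_ hn'
    have := Real.exp_one_lt_d9
    have h4 : Real.exp 4 = Real.exp 1 ^ 4 := by rw [← Real.exp_nat_mul]; norm_num
    rw [h4]
    calc Real.exp 1 ^ 4 ≤ 3 ^ 4 := pow_le_pow_left₀ (Real.exp_pos _).le (by linarith) 4
      _ ≤ 100 := by norm_num
  set x := Real.exp (-((m : ℝ) / (8 * n)))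
  have hx : 1 + x ≤ Real.exp x := by linarith [Real.add_one_le_exp x]
  have hx3 : (n : ℝ) ^ 3 * x ≤ 1 / 2 := by
    have e1 : (n : ℝ) ^ 3 = Real.exp (3 * Real.log n) := by
      rw [show (3 : ℝ) * Real.log n = ((3 : ℕ) : ℝ) * Real.log n by norm_num,
        Real.exp_nat_mul, Real.exp_log (by linarith)]
    have e2 : (n : ℝ) ^ 3 * x ≤ Real.exp (-1) := by
      rw [e1, ← Real.exp_add, Real.exp_le_exp]
      have : (3 * Real.log n + 1) ≤ (m : ℝ) / (8 * n) := by
        rw [le_div_iff₀ (by linarith)]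
        nlinarith
      linarith
    refine e2.trans ?_
    rw [Real.exp_neg, inv_le_comm₀ (Real.exp_pos _) (by norm_num)]
    have := Real.add_one_le_exp 1
    linarith
  calc (1 + x) ^ (n ^ 3) ≤ Real.exp x ^ (n ^ 3) :=
        pow_le_pow_left₀ (by positivity) hx _
    _ = Real.exp ((n : ℝ) ^ 3 * x) := by rw [← Real.exp_nat_mul]; push_cast; rfl
    _ ≤ Real.exp (1 / 2) := Real.exp_le_exp.mpr hx3
    _ < 2 := by
      rw [← Real.lt_log_iff_exp_lt (by norm_num)]
      linarith [Real.log_two_gt_d9]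

end PM

open PM in
/-- Static Permutation Mastermind: for large `n` there is a set `Q` of at most
`28 n log n` permutation queries whose answer vector determines every codeword. -/
theorem stmt_16 :
    ∃ n₀ : ℕ, ∀ n ≥ n₀,
      ∃ Q : Finset (Equiv.Perm (Fin n)),
        (Q.card : ℝ) ≤ 28 * n * Real.log n ∧
        ∀ σ τ : Equiv.Perm (Fin n),
          (∀ q ∈ Q,
            (Finset.univ.filter (fun i => q i = σ i)).card =
              (Finset.univ.filter (fun i => q i = τ i)).card) → σ = τ := by
  classical
  refine ⟨100, fun n hn => ?_⟩
  have hn25 : 25 ≤ n := by omega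
  have hn' : (100 : ℝ) ≤ n := by exact_mod_cast hn
  have hpos : 0 ≤ 28 * (n : ℝ) * Real.log n :=
    mul_nonneg (by linarith) (Real.log_nonneg (by linarith))
  obtain ⟨m, hm⟩ : ∃ m, m = ⌊28 * (n : ℝ) * Real.log n⌋₊ := ⟨_, rfl⟩
  have hm1 : (m : ℝ) ≤ 28 * n * Real.log n := hm ▸ Nat.floor_le hpos
  have hm2 : 28 * n * Real.log n < m + 1 := hm ▸ Nat.lt_floor_add_one _
  have hnum := num hn m hm2
  set x := Real.exp (-((m : ℝ) / (8 * n))) with hx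
  have hx0 : 0 < x := Real.exp_pos _
  set V : Finset (Finset (Fin n × Fin n × Fin n)) :=
    ((univ : Finset (Equiv.Perm (Fin n) × Equiv.Perm (Fin n))).filter
      (fun p => p.1 ≠ p.2)).image (fun p => T p.1 p.2) with hV
  set B : Finset (Fin m → Equiv.Perm (Fin n)) :=
    V.biUnion (fun S => Fintype.piFinset (fun _ => Z S)) with hB
  have hVne : ∀ S ∈ V, S ∈ (univ : Finset (Finset (Fin n × Fin n × Fin n))).erase ∅ := by
    intro S hS
    simp only [hV, mem_image, mem_filter, mem_univ, true_and] at hS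
    obtain ⟨⟨σ, τ⟩, hne, rfl⟩ := hS
    simp only [mem_erase, mem_univ, and_true]
    intro h0
    apply hne
    ext1 i
    by_contra hc
    have : (i, σ i, τ i) ∈ T σ τ := by
      unfold T
      exact mem_image.mpr ⟨i, by simpa using hc, rfl⟩
    rw [h0] at this
    simp at this
  have hsum : ∑ S : Finset (Fin n × Fin n × Fin n), x ^ S.card = (1 + x) ^ (n ^ 3) := by
    have := Finset.sum_pow_mul_eq_add_pow x (1:ℝ) (univ : Finset (Fin n × Fin n × Fin n))
    simp only [one_pow, mul_one, powerset_univ] at this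
    rw [this, add_comm]
    congr 1
    simp
    ring
  have hBcard : (B.card : ℝ) < (n.factorial : ℝ) ^ m := by
    have h1 : (B.card : ℝ) ≤ ∑ S ∈ V, ((Z S).card : ℝ) ^ m := by
      have := Finset.card_biUnion_le (s := V)
        (t := fun S => Fintype.piFinset (fun _ : Fin m => Z S))
      simp only [Fintype.card_piFinset_const] at this
      exact_mod_cast this
    have h2 : ∑ S ∈ V, ((Z S).card : ℝ) ^ m ≤ ∑ S ∈ V, (n.factorial : ℝ) ^ m * x ^ S.card := by
      apply Finset.sum_le_sum
      intro S hS
      simp only [hV, mem_image, mem_filter, mem_univ, true_and] at hS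
      obtain ⟨⟨σ, τ⟩, hne, rfl⟩ := hS
      exact Z_card hn25 σ τ hne m
    have h3 : ∑ S ∈ V, x ^ S.card ≤ (1 + x) ^ (n ^ 3) - 1 := by
      rw [← hsum, ← Finset.add_sum_erase univ _ (mem_univ (∅ : Finset (Fin n × Fin n × Fin n)))]
      simp only [card_empty, pow_zero, add_sub_cancel_left]
      exact Finset.sum_le_sum_of_subset_of_nonneg hVne (fun _ _ _ => by positivity)
    rw [← Finset.mul_sum] at h2
    have hN : 0 < (n.factorial : ℝ) ^ m := by positivity
    have h4 : (n.factorial : ℝ) ^ m * ∑ S ∈ V, x ^ S.card < (n.factorial : ℝ) ^ m * 1 :=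
      mul_lt_mul_of_pos_left (by linarith) hN
    linarith
  obtain ⟨F, hF⟩ : ∃ F, F ∉ B := by
    by_contra hc
    push Not at hc
    have : B = univ := Finset.eq_univ_iff_forall.mpr hc
    rw [this] at hBcard
    simp [Fintype.card_perm] at hBcard
  refine ⟨univ.image F, ?_, ?_⟩
  · have : (univ.image F).card ≤ m := by simpa using Finset.card_image_le (s := univ) (f := F)
    have : ((univ.image F).card : ℝ) ≤ m := by exact_mod_cast this
    linarith
  · intro σ τ h
    by_contra hne
    apply hF
    simp only [hB, mem_biUnion, Fintype.mem_piFinset]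
    refine ⟨T σ τ, ?_, ?_⟩
    · exact mem_image.mpr ⟨(σ, τ), by simpa using hne, rfl⟩
    · intro j
      rw [Z_iff, X_iff]
      exact h (F j) (mem_image_of_mem _ (mem_univ j))
end
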